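/- Let $k \le d$, $n \ge 1$, and let $\lambda$ be a partition of $kn$ into at most $k$ parts. Then there exists a coherent state $w \in (\mathbb{C}^d)^{\otimes nk}$ of weight $\lambda$ (i.e., $w = \pi g v$ with $v$ a highest weight vector of weight $\lambda$, $g \in \mathsf{GL}_d(\mathbb{C})$, $\pi \in \mathsf{S}_{nk}$) such that all coordinates of $w$ in the computational basis are real and $\langle w,\ |1\rangle^{\otimes n} \otimes |2\rangle^{\otimes n} \otimes \cdots \otimes |k\rangle^{\otimes n}\rangle \neq 0$. -/

import Mathlib

open scoped BigOperators

noncomputable section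

/-- The tensor power `(ℂ^d)^{⊗ q}`, presented by coefficients in the computational basis
`|i₁ ⋯ i_q⟩`, `i_t ∈ {1, …, d}`. -/
abbrev Tens (d q : ℕ) : Type := (Fin q → Fin d) → ℂ

/-- The diagonal action of a `d × d` matrix on `(ℂ^d)^{⊗ q}`:
`g (v₁ ⊗ ⋯ ⊗ v_q) = g v₁ ⊗ ⋯ ⊗ g v_q`. -/
def glAct {d q : ℕ} (g : Matrix (Fin d) (Fin d) ℂ) (v : Tens d q) : Tens d q :=
  fun i => ∑ j : Fin q → Fin d, (∏ t, g (i t) (j t)) * v j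

/-- The action of a permutation `π ∈ S_q` on `(ℂ^d)^{⊗ q}` permuting the tensor factors:
`π (v₁ ⊗ ⋯ ⊗ v_q) = v_{π⁻¹(1)} ⊗ ⋯ ⊗ v_{π⁻¹(q)}`. -/
def permAct {d q : ℕ} (π : Equiv.Perm (Fin q)) (v : Tens d q) : Tens d q :=
  fun i => v (i ∘ π)

/-- The computational basis vector `|j₁ ⋯ j_q⟩`. -/
def ket {d q : ℕ} (j : Fin q → Fin d) : Tens d q :=
  fun i => if i = j then 1 else 0

/-- The standard Hermitian inner product on `(ℂ^d)^{⊗ q}` (conjugate-linear in the first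
argument), for which the computational basis is orthonormal. -/
def tinner {d q : ℕ} (v w : Tens d q) : ℂ :=
  ∑ i : Fin q → Fin d, (starRingEnd ℂ) (v i) * w i

/-- Upper triangular `d × d` matrices (entries below the diagonal vanish). -/
def IsUpperTriangular {d : ℕ} (g : Matrix (Fin d) (Fin d) ℂ) : Prop :=
  ∀ a b : Fin d, b < a → g a b = 0

/-- `v ∈ (ℂ^d)^{⊗ q}` is a highest weight vector of weight `μ ∈ ℕ^d`: it is nonzero, the line
`ℂ v` is stable under the Borel subgroup `B_d` of invertible upper triangular matrices, and
diagonal matrices act by `diag(t₁,…,t_d) v = t₁^{μ₁} ⋯ t_d^{μ_d} v`. -/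
def IsHWV {d q : ℕ} (μ : Fin d → ℕ) (v : Tens d q) : Prop :=
  v ≠ 0
  ∧ (∀ g : Matrix (Fin d) (Fin d) ℂ, IsUnit g.det → IsUpperTriangular g →
      ∃ c : ℂ, glAct g v = c • v)
  ∧ (∀ t : Fin d → ℂ, (∀ a, t a ≠ 0) →
      glAct (Matrix.diagonal t) v = (∏ a, t a ^ μ a) • v)

/-- A coherent state of weight `μ`: a vector of the form `π g v` with `v` a highest weight
vector of weight `μ`, `g ∈ GL_d(ℂ)` and `π ∈ S_q`. -/
def IsCoherent {d q : ℕ} (μ : Fin d → ℕ) (w : Tens d q) : Prop :=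
  ∃ (v : Tens d q) (g : Matrix (Fin d) (Fin d) ℂ) (π : Equiv.Perm (Fin q)),
    IsHWV μ v ∧ IsUnit g.det ∧ w = permAct π (glAct g v)

/-- The product `v ⊗ w` under the natural identification
`V^{⊗p} ⊗ V^{⊗q} ≅ V^{⊗(p+q)}`. -/
def tmul {d p q : ℕ} (v : Tens d p) (w : Tens d q) : Tens d (p + q) :=
  fun i => v (fun a => i (Fin.castAdd q a)) * w (fun b => i (Fin.natAdd p b))

/-- Transport along an equality of the number of tensor factors. -/
def castTens {d p q : ℕ} (h : p = q) (v : Tens d p) : Tens d q :=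
  fun i => v (fun a => i (Fin.cast h a))

/-- The element of `S_{kℓ}` determined by a permutation `τ ∈ S_k` of the `k` consecutive
blocks of size `ℓ` and permutations `σ_b ∈ S_ℓ` inside each block.  (Here `Fin (k * ℓ)` is
identified with `Fin k × Fin ℓ` via `finProdFinEquiv`, under which the pair
`(block, offset)` corresponds to `offset + ℓ * block`, i.e. blocks are consecutive of
size `ℓ`.)  These permutations form the wreath product `S_ℓ ≀ S_k ≤ S_{kℓ}`. -/
def blockPerm {k ℓ : ℕ} (τ : Equiv.Perm (Fin k)) (σ : Fin k → Equiv.Perm (Fin ℓ)) :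
    Equiv.Perm (Fin (k * ℓ)) :=
  finProdFinEquiv.symm.trans ((Equiv.prodShear τ σ).trans finProdFinEquiv)

/-- Membership in `Sym^k (Sym^ℓ ℂ^d) ⊆ (ℂ^d)^{⊗ kℓ}`, realized as the subspace of vectors
invariant under the wreath product `S_ℓ ≀ S_k` permuting the `k` consecutive blocks of
size `ℓ` among themselves and within themselves. -/
def InSymSym {d : ℕ} (k ℓ : ℕ) (v : Tens d (k * ℓ)) : Prop :=
  ∀ (τ : Equiv.Perm (Fin k)) (σ : Fin k → Equiv.Perm (Fin ℓ)),
    permAct (blockPerm τ σ) v = v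

/-- A weight on `{1, …, k}` padded with zeros to a weight on `{1, …, d}`. -/
def padWeight {k d : ℕ} (_ : k ≤ d) (lam : Fin k → ℕ) : Fin d → ℕ :=
  fun a => if h : (a : ℕ) < k then lam ⟨a, h⟩ else 0

/-- The Slater determinant `v_k = ∑_{π ∈ S_k} sgn(π) π |12⋯k⟩ ∈ (ℂ^d)^{⊗ k}`. -/
def slater (d k : ℕ) (h : k ≤ d) : Tens d k :=
  ∑ π : Equiv.Perm (Fin k),
    ((Equiv.Perm.sign π : ℤ) : ℂ) • permAct π (ket fun t => Fin.castLE h t)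

/-- The length `λ'_{j+1} = #{i : λ_i ≥ j+1}` of the `j`-th column (`0`-indexed) of the Young
diagram of `λ`; the conjugate partition. -/
def colLen (d : ℕ) (lam : Fin d → ℕ) (j : ℕ) : ℕ :=
  (Finset.univ.filter fun i : Fin d => j < lam i).card

lemma colLen_le (d : ℕ) (lam : Fin d → ℕ) (j : ℕ) : colLen d lam j ≤ d :=
  le_trans (Finset.card_filter_le _ _) (by simp)

/-- The tensor product `v 0 ⊗ v 1 ⊗ ⋯ ⊗ v (m-1) ∈ V^{⊗(c 0 + ⋯ + c (m-1))}` of a family of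
tensors `v j ∈ V^{⊗ c j}`. -/
def tprodFam {d : ℕ} : ∀ (m : ℕ) (c : Fin m → ℕ), (∀ j, Tens d (c j)) → Tens d (∑ j, c j)
  | 0, _, _ => fun _ => 1
  | m + 1, c, v =>
    castTens (Fin.sum_univ_succ c).symm
      (tmul (v 0) (tprodFam m (fun j => c j.succ) fun j => v j.succ))

/-- The highest weight vector `v_λ = v_{λ'_1} ⊗ v_{λ'_2} ⊗ ⋯ ⊗ v_{λ'_m}` of weight `λ`,
the tensor product of the Slater determinants along the `m = λ₁ = max_i λ_i` columns of the
Young diagram of `λ`. -/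
def vlam (d : ℕ) (lam : Fin d → ℕ) :
    Tens d (∑ j : Fin (Finset.univ.sup lam), colLen d lam (j : ℕ)) :=
  tprodFam (Finset.univ.sup lam) (fun j => colLen d lam (j : ℕ)) fun j =>
    slater d (colLen d lam (j : ℕ)) (colLen_le d lam (j : ℕ))

/-- The computational basis word `|i₁^{⊗n} i₂^{⊗n} ⋯ i_k^{⊗n}⟩ ∈ (ℂ^d)^{⊗ kn}`:
position `x` carries the letter `i_{⌊x/n⌋}`. -/
def blockWord (d k n : ℕ) (i : Fin k → Fin d) : Fin (k * n) → Fin d :=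
  fun x => i ⟨(x : ℕ) / n, Nat.div_lt_of_lt_mul (Nat.mul_comm k n ▸ x.isLt)⟩

/-- The computational basis word `|1^{⊗n} 2^{⊗n} ⋯ k^{⊗n}⟩ ∈ (ℂ^d)^{⊗ kn}`. -/
def baseWord (d k n : ℕ) (hkd : k ≤ d) : Fin (k * n) → Fin d :=
  blockWord d k n fun b => Fin.castLE hkd b

/-- The vector `ψ = φ^{⊗k} ∈ (ℂ^d)^{⊗ 2nk}` where `φ = ∑_{i=1}^d |i⟩^{⊗ 2n}`;
equivalently `ψ = ∑_{i₁,…,i_k} |i₁⟩^{⊗2n} ⊗ ⋯ ⊗ |i_k⟩^{⊗2n}`. -/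
def psiVec (d k n : ℕ) : Tens d (k * n + k * n) :=
  castTens (by ring) (∑ i : Fin k → Fin d, ket (blockWord d k (2 * n) i))

end

section ColumnMinors

variable {d q : ℕ} {C : Type*} [Fintype C] {len : C → ℕ}

/-- The tensor whose coordinate at a word `i` is the product over the columns `c` of the minors
of `g` with rows the letters of `i` in column `c` and the first `len c` columns of `g`. Here `e`
identifies tensor positions with the cells of a diagram with column lengths `len`. -/
noncomputable def columnMinors (hlen : ∀ c, len c ≤ d) (e : (Σ c, Fin (len c)) ≃ Fin q)
    (g : Matrix (Fin d) (Fin d) ℂ) : Tens d q :=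
  fun i => ∏ c, (Matrix.of fun r s : Fin (len c) =>
    g (i (e ⟨c, r⟩)) (Fin.castLE (hlen c) s)).det

lemma det_rows_mul {ℓ : ℕ} (hl : ℓ ≤ d) (g h : Matrix (Fin d) (Fin d) ℂ) (i : Fin ℓ → Fin d) :
    (Matrix.of fun r s : Fin ℓ => (g * h) (i r) (Fin.castLE hl s)).det =
      ∑ j : Fin ℓ → Fin d, (∏ r, g (i r) (j r)) *
        (Matrix.of fun r s : Fin ℓ => h (j r) (Fin.castLE hl s)).det := by
  have hrows : (Matrix.of fun r s : Fin ℓ => (g * h) (i r) (Fin.castLE hl s)) =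
      fun r => ∑ a : Fin d, g (i r) a • fun s : Fin ℓ => h a (Fin.castLE hl s) := by
    ext r s
    simp [Matrix.mul_apply, Finset.sum_apply]
  have hsum := (Matrix.detRowAlternating (R := ℂ) (n := Fin ℓ)).toMultilinearMap.map_sum
    (fun r (a : Fin d) => g (i r) a • fun s : Fin ℓ => h a (Fin.castLE hl s))
  rw [hrows]
  refine hsum.trans (Finset.sum_congr rfl fun j _ => ?_)
  exact MultilinearMap.map_smul_univ _ _ _

lemma glAct_columnMinors [DecidableEq C] (hlen : ∀ c, len c ≤ d)
    (e : (Σ c, Fin (len c)) ≃ Fin q) (g h : Matrix (Fin d) (Fin d) ℂ) :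
    glAct g (columnMinors hlen e h) = columnMinors hlen e (g * h) := by
  funext i
  simp only [glAct, columnMinors, det_rows_mul]
  rw [Finset.prod_univ_sum, Fintype.piFinset_univ]
  refine Fintype.sum_equiv
    ((Equiv.arrowCongr e.symm (Equiv.refl _)).trans
      (Equiv.piCurry fun (c : C) (_ : Fin (len c)) => Fin d)) _ _ fun j => ?_
  rw [Finset.prod_mul_distrib, ← Equiv.prod_comp e, Fintype.prod_sigma]
  rfl

lemma columnMinors_of_isUpperTriangular (hlen : ∀ c, len c ≤ d)
    (e : (Σ c, Fin (len c)) ≃ Fin q) {b : Matrix (Fin d) (Fin d) ℂ} (hb : IsUpperTriangular b) :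
    columnMinors hlen e b =
      (∏ c, (b.submatrix (Fin.castLE (hlen c)) (Fin.castLE (hlen c))).det) •
        columnMinors hlen e 1 := by
  funext i
  simp only [columnMinors, Pi.smul_apply, smul_eq_mul, ← Finset.prod_mul_distrib]
  refine Finset.prod_congr rfl fun c _ => ?_
  rw [mul_comm, ← Matrix.det_mul]
  congr 1
  ext r s
  simp only [Matrix.of_apply, Matrix.mul_apply, Matrix.submatrix_apply, Matrix.one_apply,
    ite_mul, one_mul, zero_mul]
  generalize i (e ⟨c, r⟩) = a
  by_cases ha : (a : ℕ) < len c
  · obtain ⟨a, rfl⟩ : ∃ a', Fin.castLE (hlen c) a' = a := ⟨⟨a, ha⟩, rfl⟩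
    simp only [(Fin.castLE_injective (hlen c)).eq_iff, Finset.sum_ite_eq, Finset.mem_univ, if_true]
  · rw [hb a _ (Fin.lt_def.2 (by simpa using s.isLt.trans_le (not_lt.1 ha)))]
    refine (Finset.sum_eq_zero fun s' _ => if_neg ?_).symm
    rintro rfl
    exact ha (by simp)

lemma columnMinors_one_ne_zero (hlen : ∀ c, len c ≤ d) (e : (Σ c, Fin (len c)) ≃ Fin q) :
    columnMinors hlen e 1 ≠ 0 := by
  intro h
  have h' := congrFun h fun x => Fin.castLE (hlen _) (e.symm x).2
  simp only [columnMinors, Pi.zero_apply] at h'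
  refine one_ne_zero (α := ℂ) (Eq.trans (Eq.symm ?_) h')
  refine Finset.prod_eq_one fun c _ => ?_
  rw [← Matrix.det_one (n := Fin (len c))]
  congr 1
  ext r s
  have hr : Fin.castLE (hlen _) (e.symm (e ⟨c, r⟩)).2 = Fin.castLE (hlen c) r := by
    rw [Equiv.symm_apply_apply]
  simp only [Matrix.of_apply, Matrix.one_apply, hr, (Fin.castLE_injective (hlen c)).eq_iff]

lemma isHWV_columnMinors [DecidableEq C] (hlen : ∀ c, len c ≤ d)
    (e : (Σ c, Fin (len c)) ≃ Fin q) :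
    IsHWV (fun a : Fin d => (Finset.univ.filter fun c => (a : ℕ) < len c).card)
      (columnMinors hlen e 1) := by
  refine ⟨columnMinors_one_ne_zero hlen e, fun g _ hg => ?_, fun t _ => ?_⟩
  · rw [glAct_columnMinors, mul_one]
    exact ⟨_, columnMinors_of_isUpperTriangular hlen e hg⟩
  · have ht : IsUpperTriangular (Matrix.diagonal t) :=
      fun a b hab => Matrix.diagonal_apply_ne _ hab.ne'
    rw [glAct_columnMinors, mul_one, columnMinors_of_isUpperTriangular hlen e ht]
    congr 1
    have hcol (c : C) : ((Matrix.diagonal t).submatrix (Fin.castLE (hlen c))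
        (Fin.castLE (hlen c))).det = ∏ a : Fin d, if (a : ℕ) < len c then t a else 1 := by
      rw [Matrix.submatrix_diagonal _ _ (Fin.castLE_injective _), Matrix.det_diagonal,
        ← Finset.prod_filter]
      refine Finset.prod_bij (fun s _ => Fin.castLE (hlen c) s) (by simp)
        (fun _ _ _ _ h => Fin.castLE_injective _ h) (fun a ha => ?_) (fun _ _ => rfl)
      exact ⟨⟨a, (Finset.mem_filter.1 ha).2⟩, Finset.mem_univ _, rfl⟩
    simp only [hcol]
    rw [Finset.prod_comm]
    refine Finset.prod_congr rfl fun a _ => ?_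
    rw [← Finset.prod_filter, Finset.prod_const]

end ColumnMinors

lemma tinner_ket {d q : ℕ} (v : Tens d q) (j : Fin q → Fin d) :
    tinner v (ket j) = (starRingEnd ℂ) (v j) := by
  simp [tinner, ket]

/-- For an antitone tuple, `a < colLen k lam c` if and only if the cell in row `a` and column
`c` lies in the diagram. -/
lemma lt_colLen_iff {k : ℕ} {lam : Fin k → ℕ} (hlam : Antitone lam) (a : Fin k) (c : ℕ) :
    (a : ℕ) < colLen k lam c ↔ c < lam a := by
  constructor
  · intro h
    by_contra hc
    have hsub : (Finset.univ.filter fun i : Fin k => c < lam i) ⊆ Finset.Iio a := by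
      intro i hi
      rw [Finset.mem_Iio]
      by_contra hia
      exact hc ((Finset.mem_filter.1 hi).2.trans_le (hlam (not_lt.1 hia)))
    have := Finset.card_le_card hsub
    rw [Fin.card_Iio] at this
    exact absurd h (not_lt.2 this)
  · intro h
    have hsub : Finset.Iic a ⊆ (Finset.univ.filter fun i : Fin k => c < lam i) := by
      intro i hi
      simpa using h.trans_le (hlam (Finset.mem_Iic.1 hi))
    have := Finset.card_le_card hsub
    rw [Fin.card_Iic] at this
    exact this

lemma card_filter_fin_lt {m l : ℕ} (h : l ≤ m) :
    (Finset.univ.filter fun c : Fin m => (c : ℕ) < l).card = l := by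
  rw [Fin.card_filter_val_lt, min_eq_right h]

lemma sum_colLen {k m : ℕ} {lam : Fin k → ℕ} (hm : ∀ i, lam i ≤ m) :
    ∑ c : Fin m, colLen k lam c = ∑ i, lam i := by
  simp only [colLen, Finset.card_filter]
  rw [Finset.sum_comm]
  refine Finset.sum_congr rfl fun i _ => ?_
  rw [← Finset.card_filter, card_filter_fin_lt (hm i)]

lemma padWeight_eq_card {k d m : ℕ} (hkd : k ≤ d) {lam : Fin k → ℕ} (hlam : Antitone lam)
    (hm : ∀ i, lam i ≤ m) :
    padWeight hkd lam = fun a : Fin d =>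
      (Finset.univ.filter fun c : Fin m => (a : ℕ) < colLen k lam c).card := by
  funext a
  unfold padWeight
  split_ifs with h
  · rw [← card_filter_fin_lt (hm ⟨a, h⟩)]
    congr 1
    ext c
    simpa using (lt_colLen_iff hlam ⟨a, h⟩ c).symm
  · symm
    rw [Finset.card_eq_zero, Finset.filter_eq_empty_iff]
    intro c _ hc
    exact h (hc.trans_le (colLen_le k lam c))

/-- The permutation `x ↦ x / k + n * (x % k)` of `Fin (k * n)`, sending the residue classes
modulo `k` to the consecutive blocks of size `n`. -/
def residueToBlock (k n : ℕ) : Equiv.Perm (Fin (k * n)) :=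
  (finCongr (mul_comm k n)).trans
    (finProdFinEquiv.symm.trans ((Equiv.prodComm _ _).trans finProdFinEquiv))

lemma baseWord_residueToBlock {d k n : ℕ} (hkd : k ≤ d) (x : Fin (k * n)) :
    ((baseWord d k n hkd (residueToBlock k n x) : Fin d) : ℕ) = (x : ℕ) % k := by
  have hx : (x : ℕ) / k < n := Nat.div_lt_of_lt_mul x.isLt
  have hval : ((residueToBlock k n x : Fin (k * n)) : ℕ) = (x : ℕ) / k + n * ((x : ℕ) % k) := by
    simp [residueToBlock]
  simp only [baseWord, blockWord, Fin.val_castLE, hval]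
  rw [Nat.add_mul_div_left _ _ (Nat.zero_lt_of_lt hx), Nat.div_eq_of_lt hx, zero_add]

/-- For `k ≤ d`, `n ≥ 1` and a partition `λ` of `kn` into at most `k` parts, there is a
coherent state `w ∈ (ℂ^d)^{⊗ nk}` of weight `λ` all of whose coordinates in the
computational basis are real, such that `⟨w, |1⟩^{⊗n} ⊗ |2⟩^{⊗n} ⊗ ⋯ ⊗ |k⟩^{⊗n}⟩ ≠ 0`. -/
theorem exists_real_coherent_state (d k n : ℕ) (hk : 1 ≤ k) (hkd : k ≤ d) (hn : 1 ≤ n)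
    (lam : Fin k → ℕ) (hlam : Antitone lam) (hsum : ∑ i, lam i = k * n) :
    ∃ w : Tens d (k * n),
      IsCoherent (padWeight hkd lam) w ∧
      (∀ j : Fin (k * n) → Fin d, (w j).im = 0) ∧
      tinner w (ket (baseWord d k n hkd)) ≠ 0 := by
  have hm (i : Fin k) : lam i ≤ k * n :=
    hsum ▸ Finset.single_le_sum (fun _ _ => Nat.zero_le _) (Finset.mem_univ i)
  let len : Fin (k * n) → ℕ := fun c => colLen k lam c
  have hlen (c : Fin (k * n)) : len c ≤ d := (colLen_le k lam c).trans hkd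
  let e : (Σ c, Fin (len c)) ≃ Fin (k * n) :=
    finSigmaFinEquiv.trans (finCongr ((sum_colLen hm).trans hsum))
  let V : Matrix (Fin d) (Fin d) ℂ := Matrix.vandermonde fun a : Fin d => ((a : ℕ) : ℂ)
  have hcast : Function.Injective fun a : Fin d => ((a : ℕ) : ℂ) :=
    Nat.cast_injective.comp Fin.val_injective
  have hreal (j : Fin (k * n) → Fin d) :
      (starRingEnd ℂ) (columnMinors hlen e V j) = columnMinors hlen e V j := by
    simp only [columnMinors, map_prod, RingHom.map_det]
    refine Finset.prod_congr rfl fun c _ => congrArg Matrix.det ?_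
    ext r s
    simp [V, Matrix.vandermonde_apply]
  refine ⟨permAct (residueToBlock k n) (columnMinors hlen e V),
    ⟨columnMinors hlen e 1, V, residueToBlock k n, ?_, ?_, ?_⟩, fun j => ?_, ?_⟩
  · rw [padWeight_eq_card hkd hlam hm]
    exact isHWV_columnMinors hlen e
  · exact isUnit_iff_ne_zero.2 (Matrix.det_vandermonde_ne_zero_iff.2 hcast)
  · rw [glAct_columnMinors, mul_one]
  · exact Complex.conj_eq_iff_im.1 (hreal _)
  · rw [tinner_ket]
    simp only [permAct, hreal]
    refine Finset.prod_ne_zero_iff.2 fun c _ => ?_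
    refine (Matrix.det_vandermonde_ne_zero_iff (v := fun r : Fin (len c) =>
      (((baseWord d k n hkd ∘ residueToBlock k n) (e ⟨c, r⟩) : ℕ) : ℂ))).2
      (hcast.comp fun r r' hrr => ?_)
    have hmod : ((e ⟨c, r⟩ : Fin (k * n)) : ℕ) % k = ((e ⟨c, r'⟩ : Fin (k * n)) : ℕ) % k := by
      simpa only [Function.comp_apply, baseWord_residueToBlock] using congrArg Fin.val hrr
    have hval (r : Fin (len c)) : ((e ⟨c, r⟩ : Fin (k * n)) : ℕ) =
        ∑ j : Fin (c : ℕ), len (Fin.castLE c.isLt.le j) + r := by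
      simp [e]
    rw [hval, hval] at hmod
    have hk' : len c ≤ k := colLen_le k lam c
    have hrr' := Nat.ModEq.add_left_cancel' _ hmod
    exact Fin.ext (hrr'.eq_of_lt_of_lt (r.isLt.trans_le hk') (r'.isLt.trans_le hk'))
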